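/- arXiv:2504.11903 — 4 statements merged into one kernel-verified Lean document; each statement's English description precedes it below -/
import Mathlib

section
/- Let h : ℝ^d → ℝ be ρ-weakly convex (ρ ≥ 0), let α > 0 with αρ < 1, and let z₀, Δ ∈ ℝ^d. If z⁺ is a minimizer over ℝ^d of z ↦ h(z) + (1/(2α))‖z − (z₀ − αΔ)‖², then h(z⁺) ≤ h(z₀) − ⟨Δ, z⁺ − z₀⟩ − ((2 − αρ)/(2α))·‖z⁺ − z₀‖². -/
open scoped RealInnerProductSpace

/-- Along a segment, a function `h` with `h + (ρ/2)‖·‖²` convex violates convexity by at most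
`(ρ/2) t (1 - t) ‖y - x‖²`. -/
theorem weaklyConvex_segment_le {E : Type*} [NormedAddCommGroup E] [InnerProductSpace ℝ E]
    {ρ : ℝ} {h : E → ℝ} (hwc : ConvexOn ℝ Set.univ (fun z => h z + ρ / 2 * ‖z‖ ^ 2))
    (x y : E) {t : ℝ} (ht0 : 0 ≤ t) (ht1 : t ≤ 1) :
    h (x + t • (y - x)) ≤ (1 - t) * h x + t * h y + ρ / 2 * (t * (1 - t)) * ‖y - x‖ ^ 2 := by
  have hconv := hwc.2 (Set.mem_univ x) (Set.mem_univ y) (sub_nonneg.2 ht1) ht0 (by ring)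
  have hpoint : (1 - t) • x + t • y = x + t • (y - x) := by module
  have hnorm : ‖x + t • (y - x)‖ ^ 2 =
      (1 - t) * ‖x‖ ^ 2 + t * ‖y‖ ^ 2 - t * (1 - t) * ‖y - x‖ ^ 2 := by
    rw [← hpoint, norm_add_sq_real, norm_sub_sq_real, norm_smul, norm_smul, mul_pow, mul_pow,
      Real.norm_eq_abs, Real.norm_eq_abs, sq_abs, sq_abs, real_inner_smul_left,
      real_inner_smul_right, real_inner_comm x y]
    ring
  simp only [hpoint, smul_eq_mul, hnorm] at hconv
  linarith

theorem nonpos_of_forall_le_mul {a c : ℝ} (hc : 0 ≤ c)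
    (hle : ∀ t : ℝ, 0 < t → t ≤ 1 → a ≤ t * c) : a ≤ 0 := by
  by_contra! ha
  have hac : 0 < a + c := by linarith
  have key := hle (a / (a + c)) (div_pos ha hac) ((div_le_one hac).2 (by linarith))
  rw [div_mul_eq_mul_div, le_div_iff₀ hac] at key
  nlinarith

/-- If `h` is `ρ`-weakly convex, `α > 0` with `αρ < 1`, and `z⁺` minimizes
`z ↦ h(z) + (1/(2α))‖z − (z₀ − αΔ)‖²`, then
`h(z⁺) ≤ h(z₀) − ⟨Δ, z⁺ − z₀⟩ − ((2 − αρ)/(2α))‖z⁺ − z₀‖²`. -/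
theorem prox_descent_weakly_convex {d : ℕ} {ρ α : ℝ}
    (hρ : 0 ≤ ρ) (hα : 0 < α) (hαρ : α * ρ < 1)
    (h : EuclideanSpace ℝ (Fin d) → ℝ)
    (hwc : ConvexOn ℝ Set.univ (fun z => h z + ρ / 2 * ‖z‖ ^ 2))
    (z0 Δ zp : EuclideanSpace ℝ (Fin d))
    (hmin : IsMinOn (fun z => h z + 1 / (2 * α) * ‖z - (z0 - α • Δ)‖ ^ 2) Set.univ zp) :
    h zp ≤ h z0 - ⟪Δ, zp - z0⟫ - (2 - α * ρ) / (2 * α) * ‖zp - z0‖ ^ 2 := by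
  have hcoef : 0 ≤ (1 / (2 * α) - ρ / 2) * ‖z0 - zp‖ ^ 2 := by
    refine mul_nonneg ?_ (sq_nonneg _)
    rw [sub_nonneg, div_le_div_iff₀ two_pos (by positivity)]
    linarith
  have hinner : ⟪Δ, zp - z0⟫ = -⟪Δ, z0 - zp⟫ := by rw [← inner_neg_right, neg_sub]
  have hgap : h zp - (h z0 + ⟪Δ, z0 - zp⟫ - (2 - α * ρ) / (2 * α) * ‖z0 - zp‖ ^ 2) ≤ 0 := by
    refine nonpos_of_forall_le_mul hcoef fun t ht0 ht1 => ?_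
    have hseg := weaklyConvex_segment_le hwc zp z0 ht0.le ht1
    have hopt : h zp + 1 / (2 * α) * ‖zp - (z0 - α • Δ)‖ ^ 2 ≤ h (zp + t • (z0 - zp)) +
        1 / (2 * α) * ‖zp + t • (z0 - zp) - (z0 - α • Δ)‖ ^ 2 :=
      hmin (Set.mem_univ _)
    have hexpand : ‖zp + t • (z0 - zp) - (z0 - α • Δ)‖ ^ 2 = ‖zp - (z0 - α • Δ)‖ ^ 2 +
        2 * t * (α * ⟪Δ, z0 - zp⟫ - ‖z0 - zp‖ ^ 2) + t ^ 2 * ‖z0 - zp‖ ^ 2 := by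
      rw [show zp + t • (z0 - zp) - (z0 - α • Δ) = (zp - (z0 - α • Δ)) + t • (z0 - zp) by abel,
        norm_add_sq_real, norm_smul, mul_pow, Real.norm_eq_abs, sq_abs, real_inner_smul_right,
        show zp - (z0 - α • Δ) = α • Δ - (z0 - zp) by abel, inner_sub_left,
        real_inner_smul_left, real_inner_self_eq_norm_sq]
      ring
    rw [hexpand] at hopt
    refine le_of_mul_le_mul_left ?_ ht0
    have hsum := hopt.trans (add_le_add_left hseg _)
    generalize ‖z0 - zp‖ ^ 2 = N at *
    generalize ⟪Δ, z0 - zp⟫ = D at *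
    rw [← sub_nonneg] at hsum ⊢
    convert hsum using 1
    field_simp
    ring
  rw [hinner, norm_sub_rev zp z0]
  linarith
end

section
/- Let h : ℝ^d → ℝ be ρ-weakly convex (ρ ≥ 0), let τ > 0 with τρ < 1, and let x, y ∈ ℝ^d. If u is a minimizer over ℝ^d of z ↦ h(z) + (1/(2τ))‖z − x‖² and v is a minimizer over ℝ^d of z ↦ h(z) + (1/(2τ))‖z − y‖², then ‖u − v‖ ≤ ‖x − y‖/(1 − τρ). In other words, the proximal operator of a ρ-weakly convex function with parameter τ is Lipschitz continuous with constant 1/(1 − τρ). -/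
/-- The squared distance to a point is exactly quadratic along a segment. -/
lemma norm_segment_sub_sq {E : Type*} [NormedAddCommGroup E] [InnerProductSpace ℝ E]
    (t : ℝ) (u w x : E) :
    ‖(1 - t) • u + t • w - x‖ ^ 2 =
      (1 - t) * ‖u - x‖ ^ 2 + t * ‖w - x‖ ^ 2 - t * (1 - t) * ‖u - w‖ ^ 2 := by
  have hz : (1 - t) • u + t • w - x = (1 - t) • (u - x) + t • (w - x) := by module
  have hd : u - w = (u - x) - (w - x) := by abel
  rw [hz, hd, norm_add_sq_real, norm_sub_sq_real (u - x), norm_smul, norm_smul, mul_pow, mul_pow,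
    Real.norm_eq_abs, Real.norm_eq_abs, sq_abs, sq_abs, real_inner_smul_left,
    real_inner_smul_right]
  ring

lemma le_of_forall_one_sub_mul_le {a b : ℝ}
    (hab : ∀ t : ℝ, 0 < t → t < 1 → (1 - t) * a ≤ b) : a ≤ b := by
  have hlim : Filter.Tendsto (fun t : ℝ => (1 - t) * a) (nhdsWithin 0 (Set.Ioi 0)) (nhds a) := by
    have hc : Continuous fun t : ℝ => (1 - t) * a := by fun_prop
    simpa using (hc.tendsto 0).mono_left nhdsWithin_le_nhds
  refine le_of_tendsto hlim ?_
  filter_upwards [Ioo_mem_nhdsGT (zero_lt_one : (0 : ℝ) < 1)] with t ht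
  exact hab t ht.1 ht.2

/-- Quadratic growth of the proximal objective of a weakly convex function at a minimizer. -/
lemma IsMinOn.quadratic_growth_of_weaklyConvex {E : Type*} [NormedAddCommGroup E]
    [InnerProductSpace ℝ E] {ρ c : ℝ} {h : E → ℝ}
    (hwc : ConvexOn ℝ Set.univ (fun z => h z + ρ / 2 * ‖z‖ ^ 2)) {x u : E}
    (hu : IsMinOn (fun z => h z + c * ‖z - x‖ ^ 2) Set.univ u) (w : E) :
    h u + c * ‖u - x‖ ^ 2 + (c - ρ / 2) * ‖u - w‖ ^ 2 ≤ h w + c * ‖w - x‖ ^ 2 := by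
  suffices hs : (c - ρ / 2) * ‖u - w‖ ^ 2 ≤
      h w + c * ‖w - x‖ ^ 2 - (h u + c * ‖u - x‖ ^ 2) by linarith
  refine le_of_forall_one_sub_mul_le fun t ht0 ht1 => ?_
  have hconv := hwc.2 (Set.mem_univ u) (Set.mem_univ w) (sub_nonneg.2 ht1.le) ht0.le
    (sub_add_cancel 1 t)
  have hmin := isMinOn_iff.1 hu ((1 - t) • u + t • w) (Set.mem_univ _)
  have hnorm := norm_segment_sub_sq t u w 0
  simp only [sub_zero] at hnorm
  simp only [smul_eq_mul, hnorm] at hconv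
  simp only [norm_segment_sub_sq] at hmin
  refine le_of_mul_le_mul_left ?_ ht0
  linarith

/-- **Lipschitz continuity of the proximal operator of a weakly convex function.**
If `h` is `ρ`-weakly convex, `τ > 0` with `τρ < 1`, and `u`, `v` minimize
`z ↦ h(z) + (1/(2τ))‖z − x‖²` and `z ↦ h(z) + (1/(2τ))‖z − y‖²` respectively, then
`‖u − v‖ ≤ ‖x − y‖/(1 − τρ)`. -/
theorem prox_weakly_convex_lipschitz {d : ℕ} {ρ τ : ℝ}
    (hρ : 0 ≤ ρ) (hτ : 0 < τ) (hτρ : τ * ρ < 1)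
    (h : EuclideanSpace ℝ (Fin d) → ℝ)
    (hwc : ConvexOn ℝ Set.univ (fun z => h z + ρ / 2 * ‖z‖ ^ 2))
    (x y u v : EuclideanSpace ℝ (Fin d))
    (hu : IsMinOn (fun z => h z + 1 / (2 * τ) * ‖z - x‖ ^ 2) Set.univ u)
    (hv : IsMinOn (fun z => h z + 1 / (2 * τ) * ‖z - y‖ ^ 2) Set.univ v) :
    ‖u - v‖ ≤ ‖x - y‖ / (1 - τ * ρ) := by
  have hgu := hu.quadratic_growth_of_weaklyConvex hwc v
  have hgv := hv.quadratic_growth_of_weaklyConvex hwc u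
  rw [norm_sub_rev v u] at hgv
  have hpol : ‖v - x‖ ^ 2 - ‖u - x‖ ^ 2 + ‖u - y‖ ^ 2 - ‖v - y‖ ^ 2 =
      2 * inner ℝ (u - v) (x - y) := by
    simp only [norm_sub_sq_real, inner_sub_left, inner_sub_right]
    ring
  have hcoef : 2 * τ * (1 / (2 * τ)) = 1 := by field_simp
  have hsum : (1 - τ * ρ) * ‖u - v‖ ^ 2 ≤ inner ℝ (u - v) (x - y) := by
    set c := 1 / (2 * τ)
    have hadd : (2 * c - ρ) * ‖u - v‖ ^ 2 ≤ c * (2 * inner ℝ (u - v) (x - y)) := by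
      rw [← hpol]
      linarith
    have hmul := mul_le_mul_of_nonneg_left hadd hτ.le
    linear_combination hmul + (inner ℝ (u - v) (x - y) - ‖u - v‖ ^ 2) * hcoef
  rw [le_div_iff₀ (sub_pos.2 hτρ)]
  rcases (norm_nonneg (u - v)).eq_or_lt with h0 | hpos
  · rw [← h0, zero_mul]
    exact norm_nonneg _
  · refine le_of_mul_le_mul_left ?_ hpos
    linarith [real_inner_le_norm (u - v) (x - y)]
end

section
/- Let h : ℝ^d → ℝ be ρ-weakly convex (ρ ≥ 0) and lower semicontinuous, let f : ℝ^d → ℝ be differentiable, let α > 0 with αρ < 1, and let z, Δ ∈ ℝ^d. Let z_Δ be the (unique) minimizer over ℝ^d of w ↦ h(w) + (1/(2α))‖w − (z − αΔ)‖², let z_g be the (unique) minimizer over ℝ^d of w ↦ h(w) + (1/(2α))‖w − (z − α∇f(z))‖², and define the inexact proximal gradient G^α(z,Δ) := (z − z_Δ)/α and the exact proximal gradient G^α(z) := (z − z_g)/α. Then −‖G^α(z,Δ)‖² ≤ (1/(1−αρ)²)·‖Δ − ∇f(z)‖² − (1/2)·‖G^α(z)‖². -/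
section ProximalMap

variable {E : Type*} [NormedAddCommGroup E] [InnerProductSpace ℝ E]

theorem norm_convexCombination_sq (a b : E) (t : ℝ) :
    ‖(1 - t) • a + t • b‖ ^ 2 =
      (1 - t) * ‖a‖ ^ 2 + t * ‖b‖ ^ 2 - t * (1 - t) * ‖b - a‖ ^ 2 := by
  rw [norm_add_sq_real, norm_sub_sq_real, norm_smul, norm_smul, inner_smul_left,
    inner_smul_right, mul_pow, mul_pow, Real.norm_eq_abs, Real.norm_eq_abs, sq_abs, sq_abs,
    real_inner_comm a b]
  simp only [conj_trivial]
  ring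

/-- Quadratic growth of the proximal objective of a weakly convex function at its minimizer. -/
theorem prox_quadratic_growth {ρ α : ℝ} {h : E → ℝ}
    (hwc : ConvexOn ℝ Set.univ (fun z => h z + ρ / 2 * ‖z‖ ^ 2)) {x p : E}
    (hp : IsMinOn (fun w => h w + 1 / (2 * α) * ‖w - x‖ ^ 2) Set.univ p) (w : E) :
    h p + 1 / (2 * α) * ‖p - x‖ ^ 2 + (1 / (2 * α) - ρ / 2) * ‖w - p‖ ^ 2 ≤
      h w + 1 / (2 * α) * ‖w - x‖ ^ 2 := by
  have segment_bound : ∀ t ∈ Set.Ioo (0 : ℝ) 1,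
      h p + 1 / (2 * α) * ‖p - x‖ ^ 2 + (1 / (2 * α) - ρ / 2) * (1 - t) * ‖w - p‖ ^ 2 ≤
        h w + 1 / (2 * α) * ‖w - x‖ ^ 2 := by
    rintro t ⟨ht0, ht1⟩
    have hconv := hwc.2 (Set.mem_univ p) (Set.mem_univ w) (sub_nonneg.2 ht1.le) ht0.le
      (sub_add_cancel 1 t)
    have hmin := isMinOn_iff.1 hp ((1 - t) • p + t • w) (Set.mem_univ _)
    have hshift : (1 - t) • p + t • w - x = (1 - t) • (p - x) + t • (w - x) := by module
    simp only [smul_eq_mul, norm_convexCombination_sq] at hconv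
    simp only [hshift, norm_convexCombination_sq, sub_sub_sub_cancel_right] at hmin
    refine le_of_mul_le_mul_left ?_ ht0
    linear_combination hconv + hmin
  have hlim : Filter.Tendsto
      (fun t : ℝ => h p + 1 / (2 * α) * ‖p - x‖ ^ 2 +
        (1 / (2 * α) - ρ / 2) * (1 - t) * ‖w - p‖ ^ 2) (nhdsWithin 0 (Set.Ioi 0))
      (nhds (h p + 1 / (2 * α) * ‖p - x‖ ^ 2 +
        (1 / (2 * α) - ρ / 2) * (1 - 0) * ‖w - p‖ ^ 2)) :=
    (Continuous.tendsto (by fun_prop) 0).mono_left nhdsWithin_le_nhds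
  rw [sub_zero, mul_one] at hlim
  exact le_of_tendsto hlim
    (Filter.mem_of_superset (Ioo_mem_nhdsGT one_pos) segment_bound)

/-- The proximal map of a `ρ`-weakly convex function is `1 / (1 - α * ρ)`-Lipschitz. -/
theorem prox_lipschitz {ρ α : ℝ} (hα : 0 < α) {h : E → ℝ}
    (hwc : ConvexOn ℝ Set.univ (fun z => h z + ρ / 2 * ‖z‖ ^ 2)) {x y p q : E}
    (hp : IsMinOn (fun w => h w + 1 / (2 * α) * ‖w - x‖ ^ 2) Set.univ p)
    (hq : IsMinOn (fun w => h w + 1 / (2 * α) * ‖w - y‖ ^ 2) Set.univ q) :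
    (1 - α * ρ) * ‖p - q‖ ≤ ‖x - y‖ := by
  have hpq := prox_quadratic_growth hwc hp q
  have hqp := prox_quadratic_growth hwc hq p
  rw [norm_sub_rev q p] at hpq
  have hinner : ‖q - x‖ ^ 2 - ‖p - x‖ ^ 2 + ‖p - y‖ ^ 2 - ‖q - y‖ ^ 2 =
      2 * inner ℝ (p - q) (x - y) := by
    simp only [norm_sub_sq_real, inner_sub_left, inner_sub_right]
    ring
  have hcs := real_inner_le_norm (p - q) (x - y)
  have hsum : (1 / α - ρ) * ‖p - q‖ ^ 2 ≤ 1 / α * inner ℝ (p - q) (x - y) := by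
    have hhalf : 1 / (2 * α) = 1 / α / 2 := by field_simp
    rw [hhalf] at hpq hqp
    linear_combination hpq + hqp + 1 / α / 2 * hinner
  have hmono : (1 - α * ρ) * ‖p - q‖ ^ 2 ≤ inner ℝ (p - q) (x - y) := by
    have := mul_le_mul_of_nonneg_left hsum hα.le
    field_simp at this
    linarith
  rcases (norm_nonneg (p - q)).eq_or_lt with h0 | hpos
  · rw [← h0, mul_zero]
    exact norm_nonneg _
  · refine le_of_mul_le_mul_left ?_ hpos
    linarith

end ProximalMap


/-- Relation between the inexact proximal gradient `G^α(z,Δ) = (z − z_Δ)/α` and the exact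
proximal gradient `G^α(z) = (z − z_g)/α`:
`−‖G^α(z,Δ)‖² ≤ (1/(1−αρ)²)‖Δ − ∇f(z)‖² − (1/2)‖G^α(z)‖²`. -/
theorem inexact_prox_gradient_bound {d : ℕ} {ρ α : ℝ}
    (hρ : 0 ≤ ρ) (hα : 0 < α) (hαρ : α * ρ < 1)
    (h : EuclideanSpace ℝ (Fin d) → ℝ)
    (hwc : ConvexOn ℝ Set.univ (fun z => h z + ρ / 2 * ‖z‖ ^ 2))
    (hlsc : LowerSemicontinuous h)
    (f : EuclideanSpace ℝ (Fin d) → ℝ)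
    (hfdiff : Differentiable ℝ f)
    (z Δ zΔ zg : EuclideanSpace ℝ (Fin d))
    (hzΔ : IsMinOn (fun w => h w + 1 / (2 * α) * ‖w - (z - α • Δ)‖ ^ 2) Set.univ zΔ)
    (hzg : IsMinOn
      (fun w => h w + 1 / (2 * α) * ‖w - (z - α • gradient f z)‖ ^ 2) Set.univ zg) :
    -‖α⁻¹ • (z - zΔ)‖ ^ 2 ≤
      1 / (1 - α * ρ) ^ 2 * ‖Δ - gradient f z‖ ^ 2 - 1 / 2 * ‖α⁻¹ • (z - zg)‖ ^ 2 := by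
  have hlip := prox_lipschitz hα hwc hzΔ hzg
  have hstep : z - α • Δ - (z - α • gradient f z) = -(α • (Δ - gradient f z)) := by module
  rw [hstep, norm_neg, norm_smul, Real.norm_of_nonneg hα.le] at hlip
  have hc : 0 < 1 - α * ρ := sub_pos.2 hαρ
  have hdiff : ‖α⁻¹ • (zΔ - zg)‖ ≤ ‖Δ - gradient f z‖ / (1 - α * ρ) := by
    rw [norm_smul, norm_inv, Real.norm_of_nonneg hα.le, inv_mul_le_iff₀ hα, mul_div_assoc',
      le_div_iff₀ hc]
    linarith
  have hsq : ‖α⁻¹ • (zΔ - zg)‖ ^ 2 ≤ 1 / (1 - α * ρ) ^ 2 * ‖Δ - gradient f z‖ ^ 2 := by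
    calc ‖α⁻¹ • (zΔ - zg)‖ ^ 2 ≤ (‖Δ - gradient f z‖ / (1 - α * ρ)) ^ 2 := by gcongr
      _ = 1 / (1 - α * ρ) ^ 2 * ‖Δ - gradient f z‖ ^ 2 := by rw [div_pow, one_div_mul_eq_div]
  have hsplit : α⁻¹ • (z - zg) = α⁻¹ • (z - zΔ) + α⁻¹ • (zΔ - zg) := by module
  have htri := parallelogram_law_with_norm ℝ (α⁻¹ • (z - zΔ)) (α⁻¹ • (zΔ - zg))
  rw [← hsplit] at htri
  nlinarith [sq_nonneg ‖α⁻¹ • (z - zΔ) - α⁻¹ • (zΔ - zg)‖]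
end

section
/- Let h : ℝ^d → ℝ be ρ-weakly convex (ρ ≥ 0) and lower semicontinuous, and suppose there is B_h ≥ 0 such that every weak subgradient g of h at every point w ∈ ℝ^d satisfies ‖g‖² ≤ B_h. Let f : ℝ^d → ℝ be differentiable, let α > 0 with αρ < 1, and let z ∈ ℝ^d. Let z⁺ be the (unique) minimizer over ℝ^d of w ↦ h(w) + (1/(2α))‖w − (z − α∇f(z))‖², and define the proximal gradient G^α(z) := (z − z⁺)/α. Then −‖G^α(z)‖² ≤ B_h − (1/2)·‖∇f(z)‖². -/
open scoped RealInnerProductSpace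

lemma nonpos_of_forall_le_mul_s9 {a b : ℝ} (hab : ∀ t, 0 < t → t ≤ 1 → a ≤ t * b) : a ≤ 0 := by
  by_contra! ha
  have hpos : 0 < a + |b| := by positivity
  have hle := hab (a / (a + |b|)) (by positivity)
    ((div_le_one hpos).2 (le_add_of_nonneg_right (abs_nonneg b)))
  rw [div_mul_eq_mul_div, le_div_iff₀ hpos] at hle
  nlinarith [le_abs_self b, mul_le_mul_of_nonneg_left (le_abs_self b) ha.le]

section InnerProductSpace

variable {E : Type*} [NormedAddCommGroup E] [InnerProductSpace ℝ E]

lemma norm_add_smul_sq (x y : E) (t : ℝ) :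
    ‖x + t • y‖ ^ 2 = ‖x‖ ^ 2 + 2 * t * ⟪x, y⟫ + t ^ 2 * ‖y‖ ^ 2 := by
  rw [norm_add_sq_real, inner_smul_right, norm_smul, mul_pow, Real.norm_eq_abs, sq_abs]
  ring

/-- A weakly convex function exceeds its chords by at most a quadratic term. -/
lemma weaklyConvex_add_smul_le {ρ : ℝ} {h : E → ℝ}
    (hwc : ConvexOn ℝ Set.univ (fun z => h z + ρ / 2 * ‖z‖ ^ 2)) (p v : E) {t : ℝ}
    (ht0 : 0 ≤ t) (ht1 : t ≤ 1) :
    h (p + t • v) ≤ (1 - t) * h p + t * h (p + v) + ρ / 2 * (t * (1 - t)) * ‖v‖ ^ 2 := by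
  have key := hwc.2 (Set.mem_univ p) (Set.mem_univ (p + v)) (sub_nonneg.2 ht1) ht0
    (sub_add_cancel 1 t)
  have hcomb : (1 - t) • p + t • (p + v) = p + t • v := by module
  simp only [hcomb, smul_eq_mul] at key
  rw [norm_add_smul_sq, norm_add_sq_real p v] at key
  linarith

/-- The optimality condition of the proximal step: `(u - p) / α` is a weak subgradient at the
proximal point `p` of `u`. -/
lemma weakSubgradient_of_isMinOn_prox {ρ α : ℝ} {h : E → ℝ}
    (hwc : ConvexOn ℝ Set.univ (fun z => h z + ρ / 2 * ‖z‖ ^ 2)) {u p : E}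
    (hp : IsMinOn (fun w => h w + 1 / (2 * α) * ‖w - u‖ ^ 2) Set.univ p) (x : E) :
    h p + ⟪α⁻¹ • (u - p), x - p⟫ - ρ / 2 * ‖x - p‖ ^ 2 ≤ h x := by
  obtain ⟨v, rfl⟩ : ∃ v, x = p + v := ⟨x - p, by abel⟩
  rw [add_sub_cancel_left, real_inner_smul_left, ← neg_sub p u, inner_neg_left, ← sub_nonpos]
  refine nonpos_of_forall_le_mul_s9 (b := (1 / (2 * α) - ρ / 2) * ‖v‖ ^ 2) fun t ht0 ht1 => ?_
  have hconv := weaklyConvex_add_smul_le hwc p v ht0.le ht1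
  have hmin : h p + 1 / (2 * α) * ‖p - u‖ ^ 2 ≤
      h (p + t • v) + 1 / (2 * α) * ‖p + t • v - u‖ ^ 2 := hp (Set.mem_univ _)
  rw [add_sub_right_comm, norm_add_smul_sq] at hmin
  refine le_of_mul_le_mul_left ?_ ht0
  have hα2 : 1 / (2 * α) = α⁻¹ / 2 := by rw [one_div, mul_inv]; ring
  rw [hα2] at hmin ⊢
  linarith

end InnerProductSpace

/-- If every weak subgradient of the `ρ`-weakly convex, lower semicontinuous `h` is bounded
in squared norm by `B_h`, `f` is differentiable, and `z⁺ = prox_{αh}(z − α∇f(z))`, then the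
proximal gradient `G^α(z) = (z − z⁺)/α` satisfies `−‖G^α(z)‖² ≤ B_h − (1/2)‖∇f(z)‖²`. -/
theorem prox_gradient_lower_bound {d : ℕ} {ρ α Bh : ℝ}
    (hρ : 0 ≤ ρ) (hα : 0 < α) (hαρ : α * ρ < 1) (hBh : 0 ≤ Bh)
    (h : EuclideanSpace ℝ (Fin d) → ℝ)
    (hwc : ConvexOn ℝ Set.univ (fun z => h z + ρ / 2 * ‖z‖ ^ 2))
    (hlsc : LowerSemicontinuous h)
    (hsub : ∀ w g : EuclideanSpace ℝ (Fin d),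
      (∀ x, h w + ⟪g, x - w⟫ - ρ / 2 * ‖x - w‖ ^ 2 ≤ h x) → ‖g‖ ^ 2 ≤ Bh)
    (f : EuclideanSpace ℝ (Fin d) → ℝ)
    (hfdiff : Differentiable ℝ f)
    (z zp : EuclideanSpace ℝ (Fin d))
    (hzp : IsMinOn
      (fun w => h w + 1 / (2 * α) * ‖w - (z - α • gradient f z)‖ ^ 2) Set.univ zp) :
    -‖α⁻¹ • (z - zp)‖ ^ 2 ≤ Bh - 1 / 2 * ‖gradient f z‖ ^ 2 := by
  have hg := hsub zp _ (weakSubgradient_of_isMinOn_prox hwc hzp)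
  have hsplit : gradient f z =
      α⁻¹ • (z - zp) - α⁻¹ • (z - α • gradient f z - zp) := by
    rw [← smul_sub, show z - zp - (z - α • gradient f z - zp) = α • gradient f z by abel,
      inv_smul_smul₀ hα.ne']
  have hpar := parallelogram_law_with_norm ℝ (α⁻¹ • (z - zp))
    (α⁻¹ • (z - α • gradient f z - zp))
  rw [← hsplit] at hpar
  nlinarith [sq_nonneg ‖α⁻¹ • (z - zp) + α⁻¹ • (z - α • gradient f z - zp)‖]
end
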